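/- (Lemma 4.4) The normal curvatures of a patch and of its inverse patch in corresponding directions satisfy k̃ = −λ⁻¹ k − 2η/r²: for every point (u₀,v₀) and every (a,b) ≠ (0,0), (ẽa² + 2f̃ab + g̃b²)/(Ẽa² + 2F̃ab + G̃b²) = −λ⁻¹ · (ea² + 2fab + gb²)/(Ea² + 2Fab + Gb²) − 2η/r², evaluated at (u₀,v₀). -/

import Mathlib

noncomputable section
open scoped RealInnerProductSpace

/-- ℝ³ as Euclidean 3-space. -/
abbrev E3 : Type := EuclideanSpace ℝ (Fin 3)

/-- The cross product on ℝ³. -/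
def cross (a b : E3) : E3 :=
  (WithLp.equiv 2 (Fin 3 → ℝ)).symm
    ![a 1 * b 2 - a 2 * b 1, a 2 * b 0 - a 0 * b 2, a 0 * b 1 - a 1 * b 0]

/-- The inversion of ℝ³ with center `c` and radius `r`. -/
def inv3 (c : E3) (r : ℝ) (p : E3) : E3 :=
  c + (r ^ 2 / ‖p - c‖ ^ 2) • (p - c)

/-- Partial derivative in the first variable. -/
def pu {E : Type*} [NormedAddCommGroup E] [NormedSpace ℝ E]
    (x : ℝ → ℝ → E) (u v : ℝ) : E :=
  deriv (fun t => x t v) u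

/-- Partial derivative in the second variable. -/
def pv {E : Type*} [NormedAddCommGroup E] [NormedSpace ℝ E]
    (x : ℝ → ℝ → E) (u v : ℝ) : E :=
  deriv (fun t => x u t) v

/-- The unit normal of a patch. -/
def unormal (x : ℝ → ℝ → E3) (u v : ℝ) : E3 :=
  ‖cross (pu x u v) (pv x u v)‖⁻¹ • cross (pu x u v) (pv x u v)

/-- The conformal factor λ of the inversion along the patch. -/
def lam (c : E3) (r : ℝ) (x : ℝ → ℝ → E3) (u v : ℝ) : ℝ :=
  r ^ 2 / ‖x u v - c‖ ^ 2

/-- The support-type function η = ⟨U_x, x − c⟩. -/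
def eta (c : E3) (x : ℝ → ℝ → E3) (u v : ℝ) : ℝ :=
  ⟪unormal x u v, x u v - c⟫

/-- First fundamental form coefficient E. -/
def FFE (x : ℝ → ℝ → E3) (u v : ℝ) : ℝ := ⟪pu x u v, pu x u v⟫
/-- First fundamental form coefficient F. -/
def FFF (x : ℝ → ℝ → E3) (u v : ℝ) : ℝ := ⟪pu x u v, pv x u v⟫
/-- First fundamental form coefficient G. -/
def FFG (x : ℝ → ℝ → E3) (u v : ℝ) : ℝ := ⟪pv x u v, pv x u v⟫
/-- Second fundamental form coefficient e. -/
def SFe (x : ℝ → ℝ → E3) (u v : ℝ) : ℝ := ⟪pu (pu x) u v, unormal x u v⟫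
/-- Second fundamental form coefficient f. -/
def SFf (x : ℝ → ℝ → E3) (u v : ℝ) : ℝ := ⟪pv (pu x) u v, unormal x u v⟫
/-- Second fundamental form coefficient g. -/
def SFg (x : ℝ → ℝ → E3) (u v : ℝ) : ℝ := ⟪pv (pv x) u v, unormal x u v⟫
/-- Third fundamental form coefficient P. -/
def TFP (x : ℝ → ℝ → E3) (u v : ℝ) : ℝ := ⟪pu (unormal x) u v, pu (unormal x) u v⟫
/-- Third fundamental form coefficient Q. -/
def TFQ (x : ℝ → ℝ → E3) (u v : ℝ) : ℝ := ⟪pu (unormal x) u v, pv (unormal x) u v⟫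
/-- Third fundamental form coefficient R. -/
def TFR (x : ℝ → ℝ → E3) (u v : ℝ) : ℝ := ⟪pv (unormal x) u v, pv (unormal x) u v⟫

/-- Christoffel symbol Γ¹₁₁. -/
def Ch111 (x : ℝ → ℝ → E3) (u v : ℝ) : ℝ :=
  (FFG x u v * pu (FFE x) u v - 2 * FFF x u v * pu (FFF x) u v + FFF x u v * pv (FFE x) u v) /
    (2 * (FFE x u v * FFG x u v - FFF x u v ^ 2))
/-- Christoffel symbol Γ²₁₁. -/
def Ch211 (x : ℝ → ℝ → E3) (u v : ℝ) : ℝ :=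
  (2 * FFE x u v * pu (FFF x) u v - FFE x u v * pv (FFE x) u v - FFF x u v * pu (FFE x) u v) /
    (2 * (FFE x u v * FFG x u v - FFF x u v ^ 2))
/-- Christoffel symbol Γ¹₁₂. -/
def Ch112 (x : ℝ → ℝ → E3) (u v : ℝ) : ℝ :=
  (FFG x u v * pv (FFE x) u v - FFF x u v * pu (FFG x) u v) /
    (2 * (FFE x u v * FFG x u v - FFF x u v ^ 2))
/-- Christoffel symbol Γ²₁₂. -/
def Ch212 (x : ℝ → ℝ → E3) (u v : ℝ) : ℝ :=
  (FFE x u v * pu (FFG x) u v - FFF x u v * pv (FFE x) u v) /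
    (2 * (FFE x u v * FFG x u v - FFF x u v ^ 2))
/-- Christoffel symbol Γ¹₂₂. -/
def Ch122 (x : ℝ → ℝ → E3) (u v : ℝ) : ℝ :=
  (2 * FFG x u v * pv (FFF x) u v - FFG x u v * pu (FFG x) u v - FFF x u v * pv (FFG x) u v) /
    (2 * (FFE x u v * FFG x u v - FFF x u v ^ 2))
/-- Christoffel symbol Γ²₂₂. -/
def Ch222 (x : ℝ → ℝ → E3) (u v : ℝ) : ℝ :=
  (FFE x u v * pv (FFG x) u v - 2 * FFF x u v * pv (FFF x) u v + FFF x u v * pu (FFG x) u v) /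
    (2 * (FFE x u v * FFG x u v - FFF x u v ^ 2))

/-- The tangent map of the inversion at `p`. -/
def phiStar (c : E3) (r : ℝ) (p : E3) (w : E3) : E3 :=
  (r ^ 2 / ‖p - c‖ ^ 2) • w - (2 * r ^ 2 * ⟪p - c, w⟫ / ‖p - c‖ ^ 4) • (p - c)

theorem inner_cross_left (a b : E3) : ⟪a, cross a b⟫ = 0 := by
  simp [cross, PiLp.inner_apply, Fin.sum_univ_three]
  ring

theorem inner_cross_right (a b : E3) : ⟪b, cross a b⟫ = 0 := by
  simp [cross, PiLp.inner_apply, Fin.sum_univ_three]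
  ring

/-- Lagrange's identity. -/
theorem inner_cross_self (a b : E3) :
    ⟪cross a b, cross a b⟫ = ⟪a, a⟫ * ⟪b, b⟫ - ⟪a, b⟫ ^ 2 := by
  simp only [PiLp.inner_apply, Fin.sum_univ_three]
  simp [cross]
  ring

theorem cross_smul_smul (s : ℝ) (a b : E3) : cross (s • a) (s • b) = s ^ 2 • cross a b := by
  ext i
  fin_cases i <;> simp [cross] <;> ring

theorem cross_sub_inner_smul (k : ℝ) (p a b : E3) :
    cross (a - (k * ⟪p, a⟫) • p) (b - (k * ⟪p, b⟫) • p) =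
      (1 - k * ⟪p, p⟫) • cross a b + (k * ⟪p, cross a b⟫) • p := by
  simp only [PiLp.inner_apply, Fin.sum_univ_three]
  ext i
  fin_cases i <;> simp [cross] <;> ring

/-- The tangent map of the inversion is a multiple of a reflection. -/
theorem phiStar_eq_smul (c : E3) (r : ℝ) (p w : E3) :
    phiStar c r p w =
      (r ^ 2 / ‖p - c‖ ^ 2) • (w - (2 / ‖p - c‖ ^ 2 * ⟪p - c, w⟫) • (p - c)) := by
  rw [phiStar]
  generalize p - c = q
  match_scalars <;> ring

theorem inner_phiStar {c p : E3} (hp : p ≠ c) (r : ℝ) (a b : E3) :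
    ⟪phiStar c r p a, phiStar c r p b⟫ = (r ^ 2 / ‖p - c‖ ^ 2) ^ 2 * ⟪a, b⟫ := by
  have hq : ‖p - c‖ ≠ 0 := norm_ne_zero_iff.2 (sub_ne_zero.2 hp)
  simp only [phiStar_eq_smul]
  generalize p - c = q at hq
  simp only [inner_sub_left, inner_sub_right, real_inner_smul_left,
    real_inner_smul_right, real_inner_self_eq_norm_sq, real_inner_comm q a]
  field_simp
  ring

theorem cross_phiStar {c p : E3} (hp : p ≠ c) (r : ℝ) (a b : E3) :
    cross (phiStar c r p a) (phiStar c r p b) =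
      -((r ^ 2 / ‖p - c‖ ^ 2) • phiStar c r p (cross a b)) := by
  have hq : ‖p - c‖ ≠ 0 := norm_ne_zero_iff.2 (sub_ne_zero.2 hp)
  simp only [phiStar_eq_smul, cross_smul_smul, cross_sub_inner_smul, real_inner_self_eq_norm_sq]
  rw [div_mul_cancel₀ _ (pow_ne_zero 2 hq)]
  module

theorem norm_phiStar {c p : E3} (hp : p ≠ c) (r : ℝ) (a : E3) :
    ‖phiStar c r p a‖ = r ^ 2 / ‖p - c‖ ^ 2 * ‖a‖ := by
  rw [← sq_eq_sq₀ (norm_nonneg _) (by positivity), mul_pow, ← real_inner_self_eq_norm_sq,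
    inner_phiStar hp, real_inner_self_eq_norm_sq]

theorem phiStar_smul (c : E3) (r : ℝ) (p : E3) (s : ℝ) (w : E3) :
    phiStar c r p (s • w) = s • phiStar c r p w := by
  simp only [phiStar, real_inner_smul_right]
  module

theorem hasDerivAt_inv3 {c : E3} (r : ℝ) {γ : ℝ → E3} {γ' : E3} {t : ℝ}
    (hγ : HasDerivAt γ γ' t) (hc : γ t ≠ c) :
    HasDerivAt (fun s => inv3 c r (γ s)) (phiStar c r (γ t) γ') t := by
  have hq : ‖γ t - c‖ ≠ 0 := norm_ne_zero_iff.2 (sub_ne_zero.2 hc)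
  have hX := hγ.sub_const c
  have h := (((hasDerivAt_const t (r ^ 2)).fun_div hX.norm_sq (pow_ne_zero 2 hq)).fun_smul
    hX).const_add c
  refine h.congr_deriv ?_
  rw [phiStar]
  generalize γ t - c = q at hq
  match_scalars
  · field_simp
  · field_simp
    ring

theorem hasDerivAt_phiStar {c : E3} (r : ℝ) {γ w : ℝ → E3} {γ' w' : E3} {t : ℝ}
    (hγ : HasDerivAt γ γ' t) (hw : HasDerivAt w w' t) (hc : γ t ≠ c) :
    HasDerivAt (fun s => phiStar c r (γ s) (w s))
      (phiStar c r (γ t) w' - (2 * r ^ 2 * ⟪γ t - c, γ'⟫ / ‖γ t - c‖ ^ 4) • w t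
        - (2 * r ^ 2 * ⟪γ t - c, w t⟫ / ‖γ t - c‖ ^ 4) • γ'
        - (2 * r ^ 2 * ⟪γ', w t⟫ / ‖γ t - c‖ ^ 4
          - 8 * r ^ 2 * ⟪γ t - c, w t⟫ * ⟪γ t - c, γ'⟫ / ‖γ t - c‖ ^ 6) • (γ t - c)) t := by
  have hq : ‖γ t - c‖ ≠ 0 := norm_ne_zero_iff.2 (sub_ne_zero.2 hc)
  have hX := hγ.sub_const c
  have hN := hX.norm_sq
  have h1 := ((hasDerivAt_const t (r ^ 2)).fun_div hN (pow_ne_zero 2 hq)).fun_smul hw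
  have h2 := (((hX.inner ℝ hw).const_mul (2 * r ^ 2)).fun_div (hN.fun_pow 2)
    (pow_ne_zero 2 (pow_ne_zero 2 hq))).fun_smul hX
  have h := h1.fun_sub h2
  simp only [← pow_mul] at h
  refine h.congr_deriv ?_
  rw [phiStar]
  match_scalars <;> field_simp <;> ring

/-- The normal component of the derivative of the tangent map of the inversion along a curve. -/
theorem inner_deriv_phiStar {c : E3} (r : ℝ) {γ w : ℝ → E3} {γ' w' n : E3} {t : ℝ}
    (hγ : HasDerivAt γ γ' t) (hw : HasDerivAt w w' t) (hc : γ t ≠ c)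
    (hγn : ⟪γ', n⟫ = 0) (hwn : ⟪w t, n⟫ = 0) :
    ⟪deriv (fun s => phiStar c r (γ s) (w s)) t, phiStar c r (γ t) n⟫ =
      (r ^ 2 / ‖γ t - c‖ ^ 2) ^ 2 *
        (⟪w', n⟫ + 2 * ⟪γ', w t⟫ * ⟪n, γ t - c⟫ / ‖γ t - c‖ ^ 2) := by
  have hq : ‖γ t - c‖ ≠ 0 := norm_ne_zero_iff.2 (sub_ne_zero.2 hc)
  rw [(hasDerivAt_phiStar r hγ hw hc).deriv, inner_sub_left, inner_sub_left, inner_sub_left,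
    inner_phiStar hc, phiStar]
  generalize γ t - c = q at hq
  simp only [inner_sub_right, real_inner_smul_left, real_inner_smul_right,
    real_inner_self_eq_norm_sq, hγn, hwn, real_inner_comm q]
  field_simp
  ring

section Patch

variable {x : ℝ → ℝ → E3}

theorem hasDerivAt_pu (hx : ContDiff ℝ (⊤ : ℕ∞) (fun p : ℝ × ℝ => x p.1 p.2)) (u v : ℝ) :
    HasDerivAt (fun t => x t v) (pu x u v) u :=
  ((hx.comp (contDiff_id.prodMk contDiff_const : ContDiff ℝ _ fun t : ℝ => (t, v))).differentiable
    (by simp) u).hasDerivAt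

theorem hasDerivAt_pv (hx : ContDiff ℝ (⊤ : ℕ∞) (fun p : ℝ × ℝ => x p.1 p.2)) (u v : ℝ) :
    HasDerivAt (fun t => x u t) (pv x u v) v :=
  ((hx.comp (contDiff_const.prodMk contDiff_id : ContDiff ℝ _ fun t : ℝ => (u, t))).differentiable
    (by simp) v).hasDerivAt

theorem contDiff_pu (hx : ContDiff ℝ (⊤ : ℕ∞) (fun p : ℝ × ℝ => x p.1 p.2)) :
    ContDiff ℝ (⊤ : ℕ∞) (fun p : ℝ × ℝ => pu x p.1 p.2) := by
  have h : ContDiff ℝ (⊤ : ℕ∞) fun p => fderiv ℝ (fun p : ℝ × ℝ => x p.1 p.2) p (1, 0) :=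
    (hx.fderiv_right (by simp)).clm_apply contDiff_const
  convert h using 2 with p
  exact ((hx.differentiable (by simp) p).hasFDerivAt.comp_hasDerivAt p.1
    ((hasDerivAt_id p.1).prodMk (hasDerivAt_const p.1 p.2))).deriv

theorem contDiff_pv (hx : ContDiff ℝ (⊤ : ℕ∞) (fun p : ℝ × ℝ => x p.1 p.2)) :
    ContDiff ℝ (⊤ : ℕ∞) (fun p : ℝ × ℝ => pv x p.1 p.2) := by
  have h : ContDiff ℝ (⊤ : ℕ∞) fun p => fderiv ℝ (fun p : ℝ × ℝ => x p.1 p.2) p (0, 1) :=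
    (hx.fderiv_right (by simp)).clm_apply contDiff_const
  convert h using 2 with p
  exact ((hx.differentiable (by simp) p).hasFDerivAt.comp_hasDerivAt p.2
    ((hasDerivAt_const p.2 p.1).prodMk (hasDerivAt_id p.2))).deriv

theorem inner_pu_unormal (u v : ℝ) : ⟪pu x u v, unormal x u v⟫ = 0 := by
  rw [unormal, real_inner_smul_right, inner_cross_left, mul_zero]

theorem inner_pv_unormal (u v : ℝ) : ⟪pv x u v, unormal x u v⟫ = 0 := by
  rw [unormal, real_inner_smul_right, inner_cross_right, mul_zero]

/-- The first fundamental form of a regular patch is definite. -/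
theorem firstFundamentalForm_ne_zero {u v : ℝ} (h : cross (pu x u v) (pv x u v) ≠ 0) {a b : ℝ}
    (hab : (a, b) ≠ (0, 0)) :
    FFE x u v * a ^ 2 + 2 * FFF x u v * a * b + FFG x u v * b ^ 2 ≠ 0 := by
  intro h0
  have hE : 0 ≤ FFE x u v := real_inner_self_nonneg
  have hG : 0 ≤ FFG x u v := real_inner_self_nonneg
  have hD : 0 < FFE x u v * FFG x u v - FFF x u v ^ 2 := by
    rw [FFE, FFF, FFG, ← inner_cross_self]
    exact real_inner_self_pos.2 h
  have hb : (FFE x u v * FFG x u v - FFF x u v ^ 2) * b ^ 2 = 0 :=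
    le_antisymm (by nlinarith [sq_nonneg (FFE x u v * a + FFF x u v * b)]) (by positivity)
  have ha : (FFE x u v * FFG x u v - FFF x u v ^ 2) * a ^ 2 = 0 :=
    le_antisymm (by nlinarith [sq_nonneg (FFG x u v * b + FFF x u v * a)]) (by positivity)
  simp [hD.ne'] at ha hb
  exact hab (by rw [ha, hb])

end Patch

theorem inverse_patch_normal_curvature
    (c : E3) (r : ℝ) (hr : 0 < r)
    (x : ℝ → ℝ → E3)
    (hx : ContDiff ℝ (⊤ : ℕ∞) (fun p : ℝ × ℝ => x p.1 p.2))
    (hxc : ∀ u v : ℝ, x u v ≠ c)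
    (y : ℝ → ℝ → E3) (hy : ∀ u v : ℝ, y u v = inv3 c r (x u v))
    (hreg : ∀ u v : ℝ, cross (pu x u v) (pv x u v) ≠ 0) :
    ∀ u₀ v₀ : ℝ, ∀ a b : ℝ, (a, b) ≠ (0, 0) →
      (SFe y u₀ v₀ * a ^ 2 + 2 * SFf y u₀ v₀ * a * b + SFg y u₀ v₀ * b ^ 2) /
          (FFE y u₀ v₀ * a ^ 2 + 2 * FFF y u₀ v₀ * a * b + FFG y u₀ v₀ * b ^ 2) =
        -(lam c r x u₀ v₀)⁻¹ *
            ((SFe x u₀ v₀ * a ^ 2 + 2 * SFf x u₀ v₀ * a * b + SFg x u₀ v₀ * b ^ 2) /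
              (FFE x u₀ v₀ * a ^ 2 + 2 * FFF x u₀ v₀ * a * b + FFG x u₀ v₀ * b ^ 2)) -
          2 * eta c x u₀ v₀ / r ^ 2 := by
  obtain rfl : y = fun u v => inv3 c r (x u v) := funext₂ hy
  clear hy
  intro u v a b hab
  have hyu : pu (fun u v => inv3 c r (x u v)) = fun u v => phiStar c r (x u v) (pu x u v) :=
    funext₂ fun u v => (hasDerivAt_inv3 r (hasDerivAt_pu hx u v) (hxc u v)).deriv
  have hyv : pv (fun u v => inv3 c r (x u v)) = fun u v => phiStar c r (x u v) (pv x u v) :=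
    funext₂ fun u v => (hasDerivAt_inv3 r (hasDerivAt_pv hx u v) (hxc u v)).deriv
  have hq : ‖x u v - c‖ ≠ 0 := norm_ne_zero_iff.2 (sub_ne_zero.2 (hxc u v))
  have hl : lam c r x u v ≠ 0 := div_ne_zero (by positivity) (by positivity)
  have hN : unormal (fun u v => inv3 c r (x u v)) u v =
      -((lam c r x u v)⁻¹ • phiStar c r (x u v) (unormal x u v)) := by
    have hl0 : 0 ≤ r ^ 2 / ‖x u v - c‖ ^ 2 := by positivity
    rw [lam] at hl ⊢
    rw [unormal, unormal, hyu, hyv, cross_phiStar (hxc u v), norm_neg, norm_smul,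
      Real.norm_of_nonneg hl0, norm_phiStar (hxc u v), phiStar_smul]
    match_scalars
    field_simp
  have key : ∀ {γ w : ℝ → E3} {γ' w' : E3} {t : ℝ}, HasDerivAt γ γ' t → HasDerivAt w w' t →
      γ t = x u v → ⟪γ', unormal x u v⟫ = 0 → ⟪w t, unormal x u v⟫ = 0 →
      ⟪deriv (fun s => phiStar c r (γ s) (w s)) t, unormal (fun u v => inv3 c r (x u v)) u v⟫ =
        -(lam c r x u v * ⟪w', unormal x u v⟫
          + 2 * lam c r x u v ^ 2 * ⟪γ', w t⟫ * eta c x u v / r ^ 2) := by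
    intro γ w γ' w' t hγ hw hγt hγn hwn
    rw [hN, ← hγt, inner_neg_right, real_inner_smul_right,
      inner_deriv_phiStar r hγ hw (hγt ▸ hxc u v) hγn hwn, eta, lam, hγt]
    field_simp
  have he := key (hasDerivAt_pu hx u v) (hasDerivAt_pu (contDiff_pu hx) u v) rfl
    (inner_pu_unormal u v) (inner_pu_unormal u v)
  have hf := key (hasDerivAt_pv hx u v) (hasDerivAt_pv (contDiff_pu hx) u v) rfl
    (inner_pv_unormal u v) (inner_pu_unormal u v)
  have hg := key (hasDerivAt_pv hx u v) (hasDerivAt_pv (contDiff_pv hx) u v) rfl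
    (inner_pv_unormal u v) (inner_pv_unormal u v)
  rw [real_inner_comm (pu x u v) (pv x u v)] at hf
  have hD := firstFundamentalForm_ne_zero (hreg u v) hab
  have hE : FFE (fun u v => inv3 c r (x u v)) u v = lam c r x u v ^ 2 * FFE x u v := by
    rw [FFE, hyu]; exact inner_phiStar (hxc u v) r _ _
  have hF : FFF (fun u v => inv3 c r (x u v)) u v = lam c r x u v ^ 2 * FFF x u v := by
    rw [FFF, hyu, hyv]; exact inner_phiStar (hxc u v) r _ _
  have hG : FFG (fun u v => inv3 c r (x u v)) u v = lam c r x u v ^ 2 * FFG x u v := by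
    rw [FFG, hyv]; exact inner_phiStar (hxc u v) r _ _
  have he' : SFe (fun u v => inv3 c r (x u v)) u v = -(lam c r x u v * SFe x u v
      + 2 * lam c r x u v ^ 2 * FFE x u v * eta c x u v / r ^ 2) := by
    rw [SFe, hyu]; exact he
  have hf' : SFf (fun u v => inv3 c r (x u v)) u v = -(lam c r x u v * SFf x u v
      + 2 * lam c r x u v ^ 2 * FFF x u v * eta c x u v / r ^ 2) := by
    rw [SFf, hyu]; exact hf
  have hg' : SFg (fun u v => inv3 c r (x u v)) u v = -(lam c r x u v * SFg x u v
      + 2 * lam c r x u v ^ 2 * FFG x u v * eta c x u v / r ^ 2) := by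
    rw [SFg, hyv]; exact hg
  rw [he', hf', hg', hE, hF, hG]
  generalize hs : FFE x u v * a ^ 2 + 2 * FFF x u v * a * b + FFG x u v * b ^ 2 = s at hD ⊢
  calc
    _ = -(lam c r x u v * (SFe x u v * a ^ 2 + 2 * SFf x u v * a * b + SFg x u v * b ^ 2)
          + 2 * lam c r x u v ^ 2 * s * eta c x u v / r ^ 2) / (lam c r x u v ^ 2 * s) := by
      rw [← hs]
      congr 1 <;> ring
    _ = _ := by
      field_simp
      ring
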